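/- The curvature of the Γ-linear connection ∇ satisfies, for all i, j, k: R(δ/δx^k, δ/δx^j) ∂/∂y^i = Σ_l Rv^l_{ijk} · ∂/∂y^l, where Rv^l_{ijk} := δLv^l_{ij}/δx^k − δLv^l_{ik}/δx^j + Σ_r (Lv^r_{ij} Lv^l_{rk} − Lv^r_{ik} Lv^l_{rj}) + Σ_r Cv^l_{ir} R^r_{jk}, with R^r_{jk} := δN^r_j/δx^k − δN^r_k/δx^j. -/

import Mathlib

noncomputable section
open scoped BigOperators

/-- The local model `E = ℝ × (Fin n → ℝ) × (Fin n → ℝ)` of the 1-jet space `J¹(ℝ,M)`,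
with coordinates `(t, x, y)`. -/
abbrev E (n : ℕ) : Type := ℝ × (Fin n → ℝ) × (Fin n → ℝ)

variable {n : ℕ}

/-- Partial derivative `∂f/∂t`. -/
def pT (f : E n → ℝ) (p : E n) : ℝ := fderiv ℝ f p (1, 0, 0)

/-- Partial derivative `∂f/∂x^i`. -/
def pX (f : E n → ℝ) (i : Fin n) (p : E n) : ℝ := fderiv ℝ f p (0, Pi.single i 1, 0)

/-- Partial derivative `∂f/∂y^i`. -/
def pY (f : E n → ℝ) (i : Fin n) (p : E n) : ℝ := fderiv ℝ f p (0, 0, Pi.single i 1)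

/-- The adapted temporal frame field `δ/δt = ∂/∂t - Σ_j M^j ∂/∂y^j`. -/
def delT (M : E n → Fin n → ℝ) (p : E n) : E n := (1, 0, fun j => -(M p j))

/-- The adapted spatial frame field `δ/δx^i = ∂/∂x^i - Σ_j N^j_i ∂/∂y^j`. -/
def delX (N : E n → Fin n → Fin n → ℝ) (i : Fin n) (p : E n) : E n :=
  (0, Pi.single i 1, fun j => -(N p i j))

/-- The vertical frame field `∂/∂y^i`. -/
def delY (i : Fin n) (p : E n) : E n := ((0 : ℝ), (0 : Fin n → ℝ), Pi.single i 1)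

/-- The Lie bracket `[X,Y](p) = (DY)(p)(X(p)) - (DX)(p)(Y(p))` of vector fields on `E`. -/
def lieBr (X Y : E n → E n) (p : E n) : E n := fderiv ℝ Y p (X p) - fderiv ℝ X p (Y p)

/-- `δf/δt := ∂f/∂t - Σ_k M^k ∂f/∂y^k`. -/
def dT (M : E n → Fin n → ℝ) (f : E n → ℝ) (p : E n) : ℝ :=
  pT f p - ∑ k, M p k * pY f k p

/-- `δf/δx^i := ∂f/∂x^i - Σ_k N^k_i ∂f/∂y^k`. -/
def dX (N : E n → Fin n → Fin n → ℝ) (f : E n → ℝ) (i : Fin n) (p : E n) : ℝ :=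
  pX f i p - ∑ k, N p i k * pY f k p

/-- A d-vector field `X = a·δ/δt + Σ_i b^i·δ/δx^i + Σ_i c^i·∂/∂y^i`
given by its adapted components. -/
structure DVF (n : ℕ) where
  a : E n → ℝ
  b : E n → Fin n → ℝ
  c : E n → Fin n → ℝ

/-- The actual vector field on `E` determined by the adapted components of a `DVF`. -/
def DVF.realize (M : E n → Fin n → ℝ) (N : E n → Fin n → Fin n → ℝ) (X : DVF n)
    (p : E n) : E n :=
  (X.a p, X.b p, fun j => X.c p j - X.a p * M p j - ∑ i, X.b p i * N p i j)

/-- The nine families of adapted coefficients of a Γ-linear connection `∇`: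
`Ḡ¹₁₁, G^k_{i1}, G^{(k)(1)}_{(1)(i)1}, L̄¹_{1j}, L^k_{ij}, L^{(k)(1)}_{(1)(i)j},
C̄^{1(1)}_{1(j)}, C^{k(1)}_{i(j)}, C^{(k)(1)(1)}_{(1)(i)(j)}`. -/
structure Conn (n : ℕ) where
  Gbar : E n → ℝ
  G : E n → Fin n → Fin n → ℝ
  Gv : E n → Fin n → Fin n → ℝ
  Lbar : E n → Fin n → ℝ
  L : E n → Fin n → Fin n → Fin n → ℝ
  Lv : E n → Fin n → Fin n → Fin n → ℝ
  Cbar : E n → Fin n → ℝ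
  C : E n → Fin n → Fin n → Fin n → ℝ
  Cv : E n → Fin n → Fin n → Fin n → ℝ

/-- All nine coefficient families are smooth. -/
def Conn.Smooth (K : Conn n) : Prop :=
  ContDiff ℝ (⊤ : ℕ∞) K.Gbar ∧ ContDiff ℝ (⊤ : ℕ∞) K.G ∧ ContDiff ℝ (⊤ : ℕ∞) K.Gv ∧ ContDiff ℝ (⊤ : ℕ∞) K.Lbar ∧
  ContDiff ℝ (⊤ : ℕ∞) K.L ∧ ContDiff ℝ (⊤ : ℕ∞) K.Lv ∧ ContDiff ℝ (⊤ : ℕ∞) K.Cbar ∧ ContDiff ℝ (⊤ : ℕ∞) K.C ∧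
  ContDiff ℝ (⊤ : ℕ∞) K.Cv

/-- Derivative `X(f)(p) := Df(p)(X(p))` of `f` along the realized vector field of `X`. -/
def Xder (M : E n → Fin n → ℝ) (N : E n → Fin n → Fin n → ℝ) (X : DVF n) (f : E n → ℝ)
    (p : E n) : ℝ := fderiv ℝ f p (X.realize M N p)

/-- The Γ-linear connection `∇_X W` in adapted components. -/
def nabla (M : E n → Fin n → ℝ) (N : E n → Fin n → Fin n → ℝ) (K : Conn n)
    (X W : DVF n) : DVF n where
  a := fun p => Xder M N X W.a p +
    W.a p * (X.a p * K.Gbar p + ∑ j, X.b p j * K.Lbar p j + ∑ j, X.c p j * K.Cbar p j)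
  b := fun p k => Xder M N X (fun q => W.b q k) p +
    ∑ i, W.b p i *
      (X.a p * K.G p k i + ∑ j, X.b p j * K.L p k i j + ∑ j, X.c p j * K.C p k i j)
  c := fun p k => Xder M N X (fun q => W.c q k) p +
    ∑ i, W.c p i *
      (X.a p * K.Gv p k i + ∑ j, X.b p j * K.Lv p k i j + ∑ j, X.c p j * K.Cv p k i j)

/-- The adapted frame field `δ/δt` as a `DVF`. -/
def frT : DVF n := ⟨fun _ => 1, fun _ => 0, fun _ => 0⟩

/-- The adapted frame field `δ/δx^i` as a `DVF`. -/
def frX (i : Fin n) : DVF n := ⟨fun _ => 0, fun _ => Pi.single i 1, fun _ => 0⟩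

/-- The adapted frame field `∂/∂y^i` as a `DVF`. -/
def frY (i : Fin n) : DVF n := ⟨fun _ => 0, fun _ => 0, fun _ => Pi.single i 1⟩

/-- Decomposition of an arbitrary vector field into adapted components. -/
def decomp (M : E n → Fin n → ℝ) (N : E n → Fin n → Fin n → ℝ) (V : E n → E n) : DVF n :=
  ⟨fun p => (V p).1, fun p => (V p).2.1,
   fun p j => (V p).2.2 j + (V p).1 * M p j + ∑ i, (V p).2.1 i * N p i j⟩

/-- The torsion `T(X,Y) := ∇_X Y - ∇_Y X - [X,Y]`. -/
def torsion (M : E n → Fin n → ℝ) (N : E n → Fin n → Fin n → ℝ) (K : Conn n)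
    (X Y : DVF n) (p : E n) : E n :=
  (nabla M N K X Y).realize M N p - (nabla M N K Y X).realize M N p -
    lieBr (X.realize M N) (Y.realize M N) p

/-- The curvature `R(X,Y)Z := ∇_X(∇_Y Z) - ∇_Y(∇_X Z) - ∇_{[X,Y]}Z`. -/
def curv (M : E n → Fin n → ℝ) (N : E n → Fin n → Fin n → ℝ) (K : Conn n)
    (X Y Z : DVF n) (p : E n) : E n :=
  (nabla M N K X (nabla M N K Y Z)).realize M N p -
    (nabla M N K Y (nabla M N K X Z)).realize M N p -
    (nabla M N K (decomp M N (lieBr (X.realize M N) (Y.realize M N))) Z).realize M N p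

/-- The realized vector field of the adapted frame field `δ/δx^i` is `delX N i`. -/
theorem realize_frX (M : E n → Fin n → ℝ) (N : E n → Fin n → Fin n → ℝ) (i : Fin n) :
    (frX i).realize M N = delX N i := by
  funext p
  simp [DVF.realize, frX, delX, Pi.single_apply]

/-- The derivative of any function along `δ/δx^i` is `δf/δx^i`. -/
theorem fderiv_delX (N : E n → Fin n → Fin n → ℝ) (f : E n → ℝ) (i : Fin n) (p : E n) :
    fderiv ℝ f p (delX N i p) = dX N f i p := by
  have h : delX N i p = ((0, Pi.single i 1, 0) : E n) -
      ∑ r, N p i r • ((0, 0, Pi.single r 1) : E n) := by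
    refine Prod.ext ?_ (Prod.ext ?_ ?_)
    · simp [delX, Prod.fst_sum]
    · simp [delX, Prod.fst_sum, Prod.snd_sum]
    · funext s
      simp [delX, Prod.snd_sum, Pi.single_apply]
  rw [h, map_sub, map_sum]
  simp only [map_smul, smul_eq_mul, dX, pX, pY]

/-- The derivative of a function along the realization of `δ/δx^i` is `δf/δx^i`. -/
theorem Xder_frX (M : E n → Fin n → ℝ) (N : E n → Fin n → Fin n → ℝ) (f : E n → ℝ)
    (i : Fin n) (p : E n) : Xder M N (frX i) f p = dX N f i p := by
  rw [Xder, realize_frX, fderiv_delX]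

/-- The derivative of `delX N i` in terms of the derivatives of the components of `N`. -/
theorem fderiv_delX_apply {N : E n → Fin n → Fin n → ℝ} (hN : Differentiable ℝ N)
    (i : Fin n) (p v : E n) :
    fderiv ℝ (delX N i) p v = (0, 0, fun r => -fderiv ℝ (fun q => N q i r) p v) := by
  have hr : ∀ r, DifferentiableAt ℝ (fun q => N q i r) p := fun r =>
    differentiableAt_pi.1 (differentiableAt_pi.1 (hN p) i) r
  have hd : HasFDerivAt (delX N i) ((0 : E n →L[ℝ] ℝ).prod ((0 : E n →L[ℝ] (Fin n → ℝ)).prod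
      (ContinuousLinearMap.pi fun r => -fderiv ℝ (fun q => N q i r) p))) p :=
    (hasFDerivAt_const (0 : ℝ) p).prodMk
      ((hasFDerivAt_const (Pi.single i 1 : Fin n → ℝ) p).prodMk
        (hasFDerivAt_pi.2 fun r => (hr r).hasFDerivAt.neg))
  rw [hd.fderiv]
  rfl

/-- The bracket `[δ/δx^k, δ/δx^j] = -Σ_r (δN^r_j/δx^k - δN^r_k/δx^j) ∂/∂y^r`. -/
theorem lieBr_delX_delX {N : E n → Fin n → Fin n → ℝ} (hN : Differentiable ℝ N)
    (j k : Fin n) :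
    lieBr (delX N k) (delX N j) = fun p => (0, 0, fun r =>
      -(dX N (fun q => N q j r) k p - dX N (fun q => N q k r) j p)) := by
  funext p
  simp only [lieBr, fderiv_delX_apply hN, fderiv_delX]
  refine Prod.ext (by simp) (Prod.ext (by simp) ?_)
  funext r
  simp only [Prod.snd_sub, Pi.sub_apply]
  ring

/-- The covariant derivative along `δ/δx^k` of a vertical field. -/
theorem nabla_frX_vertical (M : E n → Fin n → ℝ) (N : E n → Fin n → Fin n → ℝ) (K : Conn n)
    (c : E n → Fin n → ℝ) (k : Fin n) :
    nabla M N K (frX k) ⟨fun _ => 0, fun _ => 0, c⟩ = ⟨fun _ => 0, fun _ => 0, fun p l =>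
      dX N (fun q => c q l) k p + ∑ r, c p r * K.Lv p l r k⟩ := by
  simp only [nabla, Xder_frX, DVF.mk.injEq]
  refine ⟨?_, ?_, ?_⟩ <;> ext <;> simp [frX, dX, pX, pY, Pi.single_apply]

/-- `∇_{δ/δx^j} ∂/∂y^i = Σ_l Lv^l_{ij} ∂/∂y^l`. -/
theorem nabla_frX_frY (M : E n → Fin n → ℝ) (N : E n → Fin n → Fin n → ℝ) (K : Conn n)
    (i j : Fin n) :
    nabla M N K (frX j) (frY i) = ⟨fun _ => 0, fun _ => 0, fun p l => K.Lv p l i j⟩ := by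
  rw [frY, nabla_frX_vertical]
  simp [dX, pX, pY, Pi.single_apply]

/-- The covariant derivative of `∂/∂y^i` along a vertical field. -/
theorem nabla_vertical_frY (M : E n → Fin n → ℝ) (N : E n → Fin n → Fin n → ℝ) (K : Conn n)
    (c : E n → Fin n → ℝ) (i : Fin n) :
    nabla M N K ⟨fun _ => 0, fun _ => 0, c⟩ (frY i) = ⟨fun _ => 0, fun _ => 0, fun p l =>
      ∑ r, c p r * K.Cv p l i r⟩ := by
  simp only [nabla, Xder, frY, DVF.mk.injEq]
  refine ⟨?_, ?_, ?_⟩ <;> ext <;> simp [Pi.single_apply]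

/-- A vertical field is realized by its own components. -/
theorem realize_vertical (M : E n → Fin n → ℝ) (N : E n → Fin n → Fin n → ℝ)
    (c : E n → Fin n → ℝ) (p : E n) :
    DVF.realize M N ⟨fun _ => 0, fun _ => 0, c⟩ p = (0, 0, c p) := by
  simp [DVF.realize]

/-- The adapted components of a vertical vector field. -/
theorem decomp_vertical (M : E n → Fin n → ℝ) (N : E n → Fin n → Fin n → ℝ)
    (c : E n → Fin n → ℝ) :
    decomp M N (fun p => (0, 0, c p)) = ⟨fun _ => 0, fun _ => 0, c⟩ := by
  simp [decomp]

/-- Expansion of a vertical vector in the frame `∂/∂y^l`. -/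
theorem sum_smul_delY (c : Fin n → ℝ) (p : E n) : ∑ l, c l • delY l p = (0, 0, c) := by
  refine Prod.ext ?_ (Prod.ext ?_ ?_)
  · simp [delY, Prod.fst_sum]
  · simp [delY, Prod.fst_sum, Prod.snd_sum]
  · funext s
    simp [delY, Prod.snd_sum, Pi.single_apply]

/-- `R(δ/δx^k, δ/δx^j) ∂/∂y^i = Σ_l Rv^l_{ijk}·∂/∂y^l`, where
`Rv^l_{ijk} := δLv^l_{ij}/δx^k − δLv^l_{ik}/δx^j + Σ_r (Lv^r_{ij} Lv^l_{rk} − Lv^r_{ik} Lv^l_{rj})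
+ Σ_r Cv^l_{ir} R^r_{jk}` and `R^r_{jk} := δN^r_j/δx^k − δN^r_k/δx^j`. -/
theorem curv_delX_delX_delY (n : ℕ) (M : E n → Fin n → ℝ) (N : E n → Fin n → Fin n → ℝ)
    (hM : ContDiff ℝ (⊤ : ℕ∞) M) (hN : ContDiff ℝ (⊤ : ℕ∞) N) (K : Conn n) (hK : K.Smooth) (i j k : Fin n) :
    curv M N K (frX k) (frX j) (frY i) = fun p =>
      ∑ l, (dX N (fun q => K.Lv q l i j) k p - dX N (fun q => K.Lv q l i k) j p
        + (∑ r, (K.Lv p r i j * K.Lv p l r k - K.Lv p r i k * K.Lv p l r j))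
        + ∑ r, K.Cv p l i r *
            (dX N (fun q => N q j r) k p - dX N (fun q => N q k r) j p)) • delY l p := by
  funext p
  rw [sum_smul_delY, curv, nabla_frX_frY, nabla_frX_frY, nabla_frX_vertical, nabla_frX_vertical,
    realize_frX, realize_frX, lieBr_delX_delX (hN.differentiable (by simp)), decomp_vertical,
    nabla_vertical_frY, realize_vertical, realize_vertical, realize_vertical]
  refine Prod.ext (by simp) (Prod.ext (by simp) ?_)
  funext l
  simp only [Prod.snd_sub, Pi.sub_apply, Finset.sum_sub_distrib, neg_mul,
    Finset.sum_neg_distrib, mul_comm (K.Cv p l i _)]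
  ring
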